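/- Let K be a number field with ring of integers O_K, let W be a Weierstrass curve y² + a₁xy + a₃y = x³ + a₂x² + a₄x + a₆ with a₁,a₂,a₃,a₄,a₆ ∈ O_K, and let P = (x₀, y₀) be a point on W with x₀, y₀ ∈ O_K. Then the sequence u_n = ψ_n(P) of values of the division polynomials at P is a divisibility sequence in O_K: whenever n divides m, ψ_n(P) divides ψ_m(P) in O_K. Hence for a point P ∈ E(K) with integral coordinates, {ψ_n(P)} is a proper elliptic divisibility sequence over O_K provided ψ₂(P)·ψ₃(P) ≠ 0. -/

import Mathlib

open Polynomial NumberField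

/-- An elliptic sequence over a commutative ring `R`. -/
def IsEllSeq {R : Type*} [CommRing R] (w : ℤ → R) : Prop :=
  ∀ m n : ℤ, w (m + n) * w (m - n) =
    w (m + 1) * w (m - 1) * w n ^ 2 - w (n + 1) * w (n - 1) * w m ^ 2

/-- A divisibility sequence: `w(n) ∣ w(m)` whenever `n ∣ m`. -/
def IsDivSeq {R : Type*} [CommRing R] (w : ℤ → R) : Prop :=
  ∀ m n : ℤ, n ∣ m → w n ∣ w m

namespace IsEllipticNet

variable {R : Type*} [CommRing R] {W : ℤ → R}

lemma atomRel_swap₁₂ (odd : W.Odd) (a b c d : ℤ) :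
    atomRel W b a c d = -atomRel W a b c d := by
  rw [atomRel, atomRel, ← neg_atom odd a b]
  ring

/-- The Plücker relation for arbitrary indices follows from those with the last two fixed. -/
lemma atom_sq_mul_atomRel {a b c d e f : ℤ} (hab : atomRel W a b e f = 0)
    (hac : atomRel W a c e f = 0) (had : atomRel W a d e f = 0) (hbc : atomRel W b c e f = 0)
    (hbd : atomRel W b d e f = 0) (hcd : atomRel W c d e f = 0) :
    atom W e f ^ 2 * atomRel W a b c d = 0 := by
  unfold atomRel at *
  linear_combination atom W e f * atom W c d * hab +
    (atom W a e * atom W b f - atom W a f * atom W b e) * hcd -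
    atom W e f * atom W b d * hac - (atom W a e * atom W c f - atom W a f * atom W c e) * hbd +
    atom W e f * atom W b c * had + (atom W a e * atom W d f - atom W a f * atom W d e) * hbc

/-- The inductive step for the relations whose last two indices are the smallest possible. -/
lemma atomRel_add_two_eq_zero (odd : W.Odd) (zero : W 0 = 0) {d N : ℤ}
    (hrec : ∀ a : ℤ, a % 2 = d → atomRel W a (a - 2) (d + 2) d = 0)
    (ih : ∀ a b c d : ℤ, d % 2 = a % 2 ∧ d % 2 = b % 2 ∧ d % 2 = c % 2 →
      |a| < N → |b| < N → |c| < N → |d| < N → atomRel W a b c d = 0)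
    (a b : ℤ) (ha : a % 2 = d) (hb : b % 2 = d) (haN : |a| ≤ N) (hbN : |b| ≤ N) :
    atomRel W a b (d + 2) d = 0 := by
  wlog ha0 : 0 ≤ a generalizing a
  · rw [← atomRel_neg₁ odd]
    exact this (-a) (by omega) (by rwa [abs_neg]) (by omega)
  wlog hb0 : 0 ≤ b generalizing b
  · rw [← atomRel_neg₂ odd]
    exact this (-b) (by omega) (by rwa [abs_neg]) (by omega)
  wlog hba : b ≤ a generalizing a b
  · rw [atomRel_swap₁₂ odd, this b hb hbN hb0 a ha haN ha0 (by omega), neg_zero]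
  rw [abs_of_nonneg ha0] at haN
  obtain rfl | hba' : b = a ∨ b ≤ a - 2 := by omega
  · rw [atomRel_same₁₂, zero, mul_zero, zero_mul]
  obtain rfl | hba'' : b = a - 2 ∨ b < a - 2 := by omega
  · exact hrec a ha
  · rw [← atomRel_avg_sub W (by omega)]
    apply ih
    · omega
    all_goals rw [abs_lt]; omega

/-- A sequence over a domain satisfying the even and odd relations satisfies all relations. -/
lemma atomRel_eq_zero [IsDomain R] (odd : W.Odd) (zero : W 0 = 0) (one : W 1 = 1) (two : W 2 ≠ 0)
    (even_rel : ∀ m : ℤ, rel W (m + 1) (m - 1) 1 0 = 0)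
    (odd_rel : ∀ m : ℤ, rel W (m + 1) m 1 0 = 0) {a b c d : ℤ}
    (parity : d % 2 = a % 2 ∧ d % 2 = b % 2 ∧ d % 2 = c % 2) : atomRel W a b c d = 0 := by
  suffices h : ∀ N : ℕ, ∀ a b c d : ℤ, d % 2 = a % 2 ∧ d % 2 = b % 2 ∧ d % 2 = c % 2 →
      |a| < N → |b| < N → |c| < N → |d| < N → atomRel W a b c d = 0 by
    refine h (a.natAbs + b.natAbs + c.natAbs + d.natAbs + 1) a b c d parity ?_ ?_ ?_ ?_ <;>
    · push_cast [Int.natCast_natAbs]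
      linarith [abs_nonneg a, abs_nonneg b, abs_nonneg c, abs_nonneg d]
  intro N
  induction N with
  | zero => exact fun a b c d _ ha ↦ absurd ha (by simp)
  | succ N ih =>
    intro a b c d parity ha hb hc hd
    push_cast at ha hb hc hd
    rw [Int.lt_add_one_iff] at ha hb hc hd
    have key : ∀ e : ℤ, d % 2 = e → atom W (e + 2) e ≠ 0 →
        (∀ a : ℤ, a % 2 = e → atomRel W a (a - 2) (e + 2) e = 0) → atomRel W a b c d = 0 := by
      intro e hde hat hrec
      have base := atomRel_add_two_eq_zero odd zero hrec ih
      refine (mul_eq_zero.mp <| atom_sq_mul_atomRel (e := e + 2) (f := e) ?_ ?_ ?_ ?_ ?_ ?_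
        ).resolve_left (pow_ne_zero 2 hat)
      all_goals apply base <;> first | assumption | omega
    obtain hpar | hpar : d % 2 = 0 ∨ d % 2 = 1 := by omega
    · refine key 0 hpar (by simp [atom, one]) fun a ha ↦ ?_
      obtain ⟨m, rfl⟩ : ∃ m, a = 2 * (m + 1) := ⟨a / 2 - 1, by omega⟩
      have := odd_rel m
      rw [rel_eq] at this
      convert this using 2
      all_goals ring
    · refine key 1 hpar (by simpa [atom, one] using two) fun a ha ↦ ?_
      obtain ⟨m, rfl⟩ : ∃ m, a = 2 * m + 1 := ⟨a / 2, by omega⟩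
      have := even_rel m
      rw [rel_even, one] at this
      have h₁ (k : ℤ) : atom W (2 * k + 1) 1 = W (k + 1) * W k := by simpa using atom_odd W k 0
      have h₃ (k : ℤ) : atom W (2 * k + 1) 3 = W (k + 2) * W (k - 1) := by
        simpa [add_assoc, one_add_one_eq_two] using atom_odd W k 1
      rw [show 2 * m + 1 - 2 = 2 * (m - 1) + 1 by ring, show (1 : ℤ) + 2 = 3 from rfl,
        atomRel, h₁, h₁, h₃, h₃, atom_odd, show atom W 3 1 = W 2 * W 1 from rfl, one]
      ring_nf at this ⊢
      simp only [one, mul_one]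
      linear_combination this

end IsEllipticNet

section NormEDS

open IsEllipticNet MvPolynomial

lemma normEDS_two_three_two (n : ℤ) : normEDS (2 : ℤ) 3 2 n = n := by
  induction n using Int.negInduction with
  | nat n =>
    induction n using normEDSRec with
    | zero => simp
    | one => simp
    | two => simp
    | three => simp
    | four => simp
    | even m h₁ h₂ h₃ h₄ h₅ =>
      have h := normEDS_even (2 : ℤ) 3 2 (m + 3)
      push_cast at *
      simp only [show (m + 3 - 1 : ℤ) = m + 2 by ring, show (m + 3 + 2 : ℤ) = m + 5 by ring,
        show (m + 3 - 2 : ℤ) = m + 1 by ring, show (m + 3 + 1 : ℤ) = m + 4 by ring,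
        h₁, h₂, h₃, h₄, h₅] at h
      apply mul_right_cancel₀ two_ne_zero
      rw [h]
      ring
    | odd m h₁ h₂ h₃ h₄ =>
      have h := normEDS_odd (2 : ℤ) 3 2 (m + 2)
      push_cast at *
      simp only [show (m + 2 + 2 : ℤ) = m + 4 by ring, show (m + 2 - 1 : ℤ) = m + 1 by ring,
        show (m + 2 + 1 : ℤ) = m + 3 by ring, h₁, h₂, h₃, h₄] at h
      rw [h]
      ring
  | neg ih n => rw [normEDS_neg, ih]

lemma exists_normEDS_universal {R : Type*} [CommRing R] (b c d : R) :
    ∃ f : MvPolynomial (Fin 3) ℤ →+* R,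
      ∀ n, f (normEDS (X 0) (X 1) (X 2) n) = normEDS b c d n :=
  ⟨(MvPolynomial.aeval ![b, c, d]).toRingHom, fun n ↦ by simp [map_normEDS]⟩

lemma normEDS_X_ne_zero {n : ℤ} (hn : n ≠ 0) :
    normEDS (X 0 : MvPolynomial (Fin 3) ℤ) (X 1) (X 2) n ≠ 0 := by
  obtain ⟨f, hf⟩ := exists_normEDS_universal (2 : ℤ) 3 2
  intro h
  exact hn <| by rw [← normEDS_two_three_two n, ← hf, h, map_zero]

lemma isEllSeq_normEDS_of_isDomain {R : Type*} [CommRing R] [IsDomain R] {b : R} (hb : b ≠ 0)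
    (c d : R) : IsEllSeq (normEDS b c d) := by
  intro m n
  have h : atomRel (normEDS b c d) (2 * m) (2 * n) (2 * 1) (2 * 0) = 0 := by
    refine atomRel_eq_zero (normEDS_neg b c d) (normEDS_zero ..) (normEDS_one ..) (by simpa)
      (fun m ↦ ?_) (fun m ↦ ?_) (by omega)
    · rw [rel_even, normEDS_one, normEDS_two, one_pow, mul_one, normEDS_even]
      ring
    · rw [rel_odd, normEDS_one, one_pow, mul_one, normEDS_odd]
      ring
  simp only [atomRel, atom_even, add_zero, sub_zero, normEDS_one] at h
  linear_combination h

/-- A normalised EDS is an elliptic sequence. -/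
theorem isEllSeq_normEDS {R : Type*} [CommRing R] (b c d : R) : IsEllSeq (normEDS b c d) := by
  obtain ⟨f, hf⟩ := exists_normEDS_universal b c d
  intro m n
  simpa [hf] using congrArg f (isEllSeq_normEDS_of_isDomain (X_ne_zero 0) (X 1) (X 2) m n)

lemma normEDS_X_dvd_normEDS_mul {k : ℤ} (hk : k ≠ 0) (n : ℕ) :
    normEDS (X 0 : MvPolynomial (Fin 3) ℤ) (X 1) (X 2) k ∣ normEDS (X 0) (X 1) (X 2) (n * k) := by
  induction n using Nat.evenOddStrongRec with
  | h_even m ih =>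
    rcases m.eq_zero_or_pos with rfl | hm
    · simp
    · refine (ih m (by omega)).trans ?_
      rw [Nat.cast_mul, mul_assoc]
      exact normEDS_dvd_normEDS_two_mul ..
  | h_odd m ih =>
    rcases m.eq_zero_or_pos with rfl | hm
    · simp
    · have h := isEllSeq_normEDS (X 0 : MvPolynomial (Fin 3) ℤ) (X 1) (X 2)
        (((m + 1 : ℕ) : ℤ) * k) (m * k)
      obtain ⟨u, hu⟩ := ih m (by omega)
      obtain ⟨v, hv⟩ := ih (m + 1) (by omega)
      rw [show ((m + 1 : ℕ) : ℤ) * k + m * k = (2 * m + 1 : ℕ) * k by push_cast; ring,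
        show ((m + 1 : ℕ) : ℤ) * k - m * k = k by push_cast; ring, hu, hv] at h
      refine (mul_dvd_mul_iff_right (normEDS_X_ne_zero hk)).mp ?_
      rw [h]
      exact dvd_sub (.mul_left ⟨u ^ 2, by ring⟩ _) (.mul_left ⟨v ^ 2, by ring⟩ _)

/-- A normalised EDS is a divisibility sequence. -/
theorem isDivSeq_normEDS {R : Type*} [CommRing R] (b c d : R) : IsDivSeq (normEDS b c d) := by
  rintro _ k ⟨n, rfl⟩
  obtain rfl | hk := eq_or_ne k 0
  · simp
  obtain ⟨f, hf⟩ := exists_normEDS_universal b c d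
  rw [mul_comm]
  induction n using Int.negInduction with
  | nat n => simpa only [hf] using map_dvd f (normEDS_X_dvd_normEDS_mul hk n)
  | neg ih n => rw [neg_mul, normEDS_neg, dvd_neg]; exact ih n

end NormEDS

/-- On the curve, the values of the division polynomials form a normalised EDS. -/
lemma WeierstrassCurve.evalEval_Ψ {R : Type*} [CommRing R] (W : WeierstrassCurve R) {x y : R}
    (h : W.toAffine.Equation x y) (n : ℤ) : (W.Ψ n).evalEval x y =
      normEDS (W.ψ₂.evalEval x y) (W.Ψ₃.eval x) (W.preΨ₄.eval x) n := by
  have hsq : W.Ψ₂Sq.eval x = W.ψ₂.evalEval x y ^ 2 := by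
    have := congrArg (evalEval x y) W.ψ₂_sq
    rw [WeierstrassCurve.Affine.Equation] at h
    simpa [h, evalEval_pow, evalEval_add, evalEval_mul, evalEval_C] using this.symm
  rw [WeierstrassCurve.Ψ, normEDS, evalEval_mul, evalEval_C, preΨ, ← coe_evalRingHom,
    map_preNormEDS]
  simp only [map_pow, coe_evalRingHom, hsq, ← pow_mul]
  split_ifs <;> simp

/-- For a point `P = (x₀, y₀)` with coordinates in the ring of integers `𝓞 K` on a
Weierstrass curve with coefficients in `𝓞 K`, the values `ψₙ(P)` form a divisibility
sequence in `𝓞 K`; hence `{ψₙ(P)}` is a proper elliptic divisibility sequence provided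
`ψ₂(P)·ψ₃(P) ≠ 0`. -/
theorem divisionPolynomial_eval_isDivSeq {K : Type*} [Field K] [NumberField K]
    (W : WeierstrassCurve (𝓞 K)) (x₀ y₀ : 𝓞 K) (hP : W.toAffine.Equation x₀ y₀) :
    (∀ m n : ℤ, n ∣ m → (W.Ψ n).evalEval x₀ y₀ ∣ (W.Ψ m).evalEval x₀ y₀) ∧
    ((W.Ψ 2).evalEval x₀ y₀ * (W.Ψ 3).evalEval x₀ y₀ ≠ 0 →
      IsEllSeq (fun n : ℤ => (W.Ψ n).evalEval x₀ y₀) ∧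
      IsDivSeq (fun n : ℤ => (W.Ψ n).evalEval x₀ y₀) ∧
      (W.Ψ 0).evalEval x₀ y₀ = 0 ∧ (W.Ψ 1).evalEval x₀ y₀ = 1) := by
  simp only [W.evalEval_Ψ hP]
  exact ⟨isDivSeq_normEDS _ _ _, fun _ ↦
    ⟨isEllSeq_normEDS _ _ _, isDivSeq_normEDS _ _ _, normEDS_zero .., normEDS_one ..⟩⟩
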